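/- arXiv:1804.05496 — 2 statements merged into one kernel-verified Lean document; each statement's English description precedes it below -/
import Mathlib

section
/- Let h ∈ ℝ and b > h. Let φ_p, φ_s, ψ_p, ψ_s : ℝ → ℂ be compactly supported continuous functions and set u := u[φ_p,φ_s] and v := u[ψ_p,ψ_s]. Let P denote the generalized stress with unit normal n = (0,1). Then the function z₁ ↦ (Pu)(z₁,b)·v(z₁,b) − (Pv)(z₁,b)·u(z₁,b) is integrable on ℝ and ∫_ℝ [ (Pu)(z₁,b)·v(z₁,b) − (Pv)(z₁,b)·u(z₁,b) ] dz₁ = 0. -/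
open Complex MeasureTheory Real Filter

noncomputable section

/-- Partial derivative in the first coordinate. -/
def pd1 (f : ℝ × ℝ → ℂ) (z : ℝ × ℝ) : ℂ := deriv (fun t => f (t, z.2)) z.1

/-- Partial derivative in the second coordinate. -/
def pd2 (f : ℝ × ℝ → ℂ) (z : ℝ × ℝ) : ℂ := deriv (fun t => f (z.1, t)) z.2

/-- Generalized stress of a vector field `u` with unit normal `n`. -/
def Pstress (μ μt lamt : ℝ) (n : ℝ × ℝ) (u : ℝ × ℝ → Fin 2 → ℂ) (z : ℝ × ℝ) : Fin 2 → ℂ :=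
  fun j =>
    ((μ + μt : ℝ) : ℂ) * ((n.1 : ℂ) * pd1 (fun w => u w j) z + (n.2 : ℂ) * pd2 (fun w => u w j) z)
      + (lamt : ℂ) * (![(n.1 : ℂ), (n.2 : ℂ)] j)
          * (pd1 (fun w => u w 0) z + pd2 (fun w => u w 1) z)
      - (μt : ℂ) * (![((-n.2 : ℝ) : ℂ), (n.1 : ℂ)] j)
          * (-(pd2 (fun w => u w 0) z) + pd1 (fun w => u w 1) z)

/-- The vertical wave number `β_k(ξ)`. -/
def betaK (k : ℝ) (ξ : ℝ) : ℂ :=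
  if |ξ| ≤ k then ((Real.sqrt (k ^ 2 - ξ ^ 2) : ℝ) : ℂ)
  else Complex.I * ((Real.sqrt (ξ ^ 2 - k ^ 2) : ℝ) : ℂ)

/-- The angular-spectrum field `u[φ_p, φ_s]` associated to densities `φ_p, φ_s` on the
line `z₂ = h`. -/
def angField (kp ks h : ℝ) (φp φs : ℝ → ℂ) (z : ℝ × ℝ) : Fin 2 → ℂ :=
  fun j =>
    (Complex.I / (2 * (π : ℂ))) *
      ((∫ ξ : ℝ, (![((ξ : ℝ) : ℂ), betaK kp ξ] j) *
          Complex.exp (Complex.I * z.1 * ξ + Complex.I * (z.2 - h) * betaK kp ξ) * φp ξ)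
        + ∫ ξ : ℝ, (![betaK ks ξ, -((ξ : ℝ) : ℂ)] j) *
          Complex.exp (Complex.I * z.1 * ξ + Complex.I * (z.2 - h) * betaK ks ξ) * φs ξ)

/-- Bilinear dot product on `ℂ²` (no conjugation). -/
def dotC (a b : Fin 2 → ℂ) : ℂ := a 0 * b 0 + a 1 * b 1

end

open scoped FourierTransform ComplexConjugate

/-- On `L¹ ∩ L²`, the Fourier integral agrees a.e. with the `L²` Fourier transform. -/
theorem fourier_toLp_two_ae_eq {f : ℝ → ℂ} (hf : Integrable f) (hf2 : MemLp f 2) :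
    ((𝓕 (hf2.toLp f) : Lp ℂ 2 (volume : Measure ℝ)) : ℝ → ℂ) =ᵐ[volume] 𝓕 f := by
  have hcont : Continuous (𝓕 f) :=
    VectorFourier.fourierIntegral_continuous continuous_fourierChar
      (L := innerₗ ℝ) continuous_inner hf
  refine ae_eq_of_integral_contDiff_smul_eq
    ((Lp.memLp _).locallyIntegrable one_le_two) hcont.locallyIntegrable fun g hg hgc => ?_
  have hgc' : HasCompactSupport (fun x => (g x : ℂ)) :=
    hgc.comp_left (g := ((↑) : ℝ → ℂ)) Complex.ofReal_zero
  let G : SchwartzMap ℝ ℂ := hgc'.toSchwartzMap (Complex.ofRealCLM.contDiff.comp hg)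
  have hG : ∀ x, G x = g x := fun _ => rfl
  have h1 := congrArg (fun T => T G)
    (Lp.fourier_toTemperedDistribution_eq (hf2.toLp f))
  simp only [TemperedDistribution.fourier_apply, Lp.toTemperedDistribution_apply,
    smul_eq_mul] at h1
  have h2 : ∫ ξ, 𝓕 (G : ℝ → ℂ) ξ * f ξ = ∫ x, G x * 𝓕 f x := by
    simpa using! VectorFourier.integral_bilin_fourierIntegral_eq_flip
      (ContinuousLinearMap.mul ℂ ℂ) (L := innerₗ ℝ)
      continuous_fourierChar continuous_inner G.integrable hf
  calc ∫ x, g x • (𝓕 (hf2.toLp f) : Lp ℂ 2 (volume : Measure ℝ)) x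
      = ∫ x, G x * (𝓕 (hf2.toLp f) : Lp ℂ 2 (volume : Measure ℝ)) x := by
        simp only [hG, Complex.real_smul]
    _ = ∫ x, (𝓕 G) x * (hf2.toLp f) x := h1.symm
    _ = ∫ x, 𝓕 (G : ℝ → ℂ) x * f x := by
        refine integral_congr_ae ?_
        filter_upwards [hf2.coeFn_toLp] with x hx
        rw [hx, SchwartzMap.fourier_coe]
    _ = ∫ x, G x * 𝓕 f x := h2
    _ = ∫ x, g x • 𝓕 f x := by simp only [hG, Complex.real_smul]

theorem memLp_two_fourier {f : ℝ → ℂ} (hf : Integrable f) (hf2 : MemLp f 2) :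
    MemLp (𝓕 f) 2 :=
  (memLp_congr_ae (fourier_toLp_two_ae_eq hf hf2)).1 (Lp.memLp _)

/-- The Parseval identity on `L¹ ∩ L²`. -/
theorem integral_fourier_mul_conj_fourier {f g : ℝ → ℂ} (hf : Integrable f) (hf2 : MemLp f 2)
    (hg : Integrable g) (hg2 : MemLp g 2) :
    ∫ x, 𝓕 f x * conj (𝓕 g x) = ∫ x, f x * conj (g x) := by
  have h := Lp.inner_fourier_eq (hg2.toLp g) (hf2.toLp f)
  rw [L2.inner_def, L2.inner_def] at h
  calc ∫ x, 𝓕 f x * conj (𝓕 g x)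
      = _ := by
        refine integral_congr_ae ?_
        filter_upwards [fourier_toLp_two_ae_eq hf hf2, fourier_toLp_two_ae_eq hg hg2]
          with x hx hy
        rw [← hx, ← hy, ← RCLike.inner_apply]
    _ = _ := h
    _ = ∫ x, f x * conj (g x) := by
        refine integral_congr_ae ?_
        filter_upwards [hf2.coeFn_toLp, hg2.coeFn_toLp] with x hx hy
        rw [hx, hy, RCLike.inner_apply]

theorem fourier_conj_comp_neg (g : ℝ → ℂ) (x : ℝ) :
    𝓕 (fun ξ => conj (g (-ξ))) x = conj (𝓕 g x) := by
  rw [fourier_real_eq_integral_exp_smul, fourier_real_eq_integral_exp_smul, ← integral_conj,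
    ← integral_neg_eq_self]
  refine integral_congr_ae (Eventually.of_forall fun ξ => ?_)
  simp [← Complex.exp_conj, Complex.conj_ofNat]

/-- Bilinear form of the Parseval identity on `L¹ ∩ L²`. -/
theorem integral_fourier_mul_fourier {f g : ℝ → ℂ} (hf : Integrable f) (hf2 : MemLp f 2)
    (hg : Integrable g) (hg2 : MemLp g 2) :
    ∫ x, 𝓕 f x * 𝓕 g x = ∫ ξ, f ξ * g (-ξ) := by
  have hn : MeasurePreserving (fun x : ℝ => -x) volume volume := Measure.measurePreserving_neg _
  have h := integral_fourier_mul_conj_fourier hf hf2 (g := fun ξ => conj (g (-ξ)))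
    ((LinearIsometryEquiv.integrable_comp_iff Complex.conjLIE).2 hg.comp_neg)
    ((hg2.comp_measurePreserving hn).star)
  simpa only [fourier_conj_comp_neg, Complex.conj_conj] using h

/-- The unnormalized Fourier synthesis `x ↦ ∫ e^{i x ξ} f(ξ) dξ`. -/
noncomputable def expIntegral (f : ℝ → ℂ) (x : ℝ) : ℂ :=
  ∫ ξ : ℝ, Complex.exp (Complex.I * x * ξ) * f ξ

theorem expIntegral_eq_fourier (f : ℝ → ℂ) (x : ℝ) :
    expIntegral f x = 𝓕 f (-(2 * π)⁻¹ * x) := by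
  rw [fourier_real_eq_integral_exp_smul, expIntegral]
  congr 1 with ξ
  rw [smul_eq_mul]
  congr 2
  push_cast
  field_simp [Real.pi_ne_zero]

theorem integrable_expIntegral_mul {f g : ℝ → ℂ} (hf : Continuous f)
    (hfc : HasCompactSupport f) (hg : Continuous g) (hgc : HasCompactSupport g) :
    Integrable fun x => expIntegral f x * expIntegral g x := by
  simp only [expIntegral_eq_fourier]
  have h := (memLp_two_fourier (hf.integrable_of_hasCompactSupport hfc)
    (hf.memLp_of_hasCompactSupport hfc)).integrable_mul
    (memLp_two_fourier (hg.integrable_of_hasCompactSupport hgc)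
    (hg.memLp_of_hasCompactSupport hgc))
  exact h.comp_mul_left' (g := fun x => 𝓕 f x * 𝓕 g x) (by simp [Real.pi_ne_zero])

theorem integral_expIntegral_mul {f g : ℝ → ℂ} (hf : Continuous f)
    (hfc : HasCompactSupport f) (hg : Continuous g) (hgc : HasCompactSupport g) :
    ∫ x, expIntegral f x * expIntegral g x = (2 * π : ℝ) * ∫ ξ, f ξ * g (-ξ) := by
  simp only [expIntegral_eq_fourier]
  rw [Measure.integral_comp_mul_left (fun x => 𝓕 f x * 𝓕 g x),
    integral_fourier_mul_fourier (hf.integrable_of_hasCompactSupport hfc)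
    (hf.memLp_of_hasCompactSupport hfc) (hg.integrable_of_hasCompactSupport hgc)
    (hg.memLp_of_hasCompactSupport hgc), Complex.real_smul]
  congr 2
  rw [inv_neg, inv_inv, abs_neg, abs_of_pos Real.two_pi_pos]

/-- The unnormalized Fourier synthesis of a continuous compactly supported function is linear. -/
theorem expIntegral_linearCombination {f g : ℝ → ℂ} (hf : Continuous f)
    (hfc : HasCompactSupport f) (hg : Continuous g) (hgc : HasCompactSupport g) (A B : ℂ)
    (x : ℝ) :
    expIntegral (fun ξ => A * f ξ + B * g ξ) x = A * expIntegral f x + B * expIntegral g x := by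
  have key : ∀ {f : ℝ → ℂ}, Continuous f → HasCompactSupport f →
      Integrable fun ξ : ℝ => Complex.exp (Complex.I * x * ξ) * f ξ := fun hf hfc =>
    Continuous.integrable_of_hasCompactSupport (by fun_prop) hfc.mul_left
  simp only [expIntegral]
  rw [← integral_const_mul, ← integral_const_mul,
    ← integral_add ((key hf hfc).const_mul A) ((key hg hgc).const_mul B)]
  congr 1 with ξ
  ring

theorem hasCompactSupport_linearCombination {f g : ℝ → ℂ} (hf : HasCompactSupport f)
    (hg : HasCompactSupport g) (a b : ℝ → ℂ) :
    HasCompactSupport (fun ξ => a ξ * f ξ + b ξ * g ξ) :=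
  HasCompactSupport.add (f := fun ξ => a ξ * f ξ) (f' := fun ξ => b ξ * g ξ)
    hf.mul_left hg.mul_left

/-- If a combination of products `f(ξ) g(-ξ)` vanishes pointwise, then the corresponding
combination of products of Fourier syntheses is integrable with vanishing integral. -/
theorem integral_expIntegral_antisymm {f g : Fin 4 → ℝ → ℂ} (hf : ∀ i, Continuous (f i))
    (hfc : ∀ i, HasCompactSupport (f i)) (hg : ∀ i, Continuous (g i))
    (hgc : ∀ i, HasCompactSupport (g i))
    (h : ∀ ξ, f 0 ξ * g 0 (-ξ) + f 1 ξ * g 1 (-ξ) = f 2 ξ * g 2 (-ξ) + f 3 ξ * g 3 (-ξ)) :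
    Integrable (fun x => (expIntegral (f 0) x * expIntegral (g 0) x
        + expIntegral (f 1) x * expIntegral (g 1) x)
        - (expIntegral (f 2) x * expIntegral (g 2) x
        + expIntegral (f 3) x * expIntegral (g 3) x)) ∧
      ∫ x, ((expIntegral (f 0) x * expIntegral (g 0) x
        + expIntegral (f 1) x * expIntegral (g 1) x)
        - (expIntegral (f 2) x * expIntegral (g 2) x
        + expIntegral (f 3) x * expIntegral (g 3) x)) = 0 := by
  have hi i := integrable_expIntegral_mul (hf i) (hfc i) (hg i) (hgc i)
  have hd i : Integrable fun ξ => f i ξ * g i (-ξ) :=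
    Continuous.integrable_of_hasCompactSupport
      ((hf i).mul ((hg i).comp continuous_neg)) (hfc i).mul_right
  refine ⟨((hi 0).fun_add (hi 1)).sub ((hi 2).fun_add (hi 3)), ?_⟩
  rw [integral_sub ((hi 0).fun_add (hi 1)) ((hi 2).fun_add (hi 3)), integral_add (hi 0) (hi 1),
    integral_add (hi 2) (hi 3)]
  simp only [integral_expIntegral_mul (hf _) (hfc _) (hg _) (hgc _)]
  rw [← mul_add, ← mul_add, ← integral_add (hd 0) (hd 1), ← integral_add (hd 2) (hd 3)]
  simp only [h, sub_self]

theorem hasDerivAt_integral_mul_cexp {g m : ℝ → ℂ} (hg : Continuous g)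
    (hgc : HasCompactSupport g) (hm : Continuous m) (t₀ : ℝ) :
    HasDerivAt (fun t : ℝ => ∫ ξ, g ξ * Complex.exp (t * m ξ))
      (∫ ξ, g ξ * m ξ * Complex.exp (t₀ * m ξ)) t₀ := by
  have hnorm : Continuous fun ξ => ‖m ξ‖ := hm.norm
  refine (hasDerivAt_integral_of_dominated_loc_of_deriv_le (𝕜 := ℝ)
    (F := fun (t : ℝ) ξ => g ξ * Complex.exp (t * m ξ))
    (F' := fun (t : ℝ) ξ => g ξ * m ξ * Complex.exp (t * m ξ))
    (bound := fun ξ => ‖g ξ‖ * (‖m ξ‖ * Real.exp ((|t₀| + 1) * ‖m ξ‖)))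
    (Metric.ball_mem_nhds t₀ one_pos) (Eventually.of_forall fun t => ?_) ?_ ?_
    (Eventually.of_forall fun ξ t ht => ?_) ?_ (Eventually.of_forall fun ξ t _ => ?_)).2
  · exact Continuous.aestronglyMeasurable (by fun_prop)
  · exact Continuous.integrable_of_hasCompactSupport (by fun_prop) hgc.mul_right
  · exact Continuous.aestronglyMeasurable (by fun_prop)
  · rw [norm_mul, norm_mul, mul_assoc]
    gcongr
    refine (Complex.norm_exp_le_exp_norm _).trans ?_
    rw [norm_mul, Complex.norm_real]
    gcongr
    rw [Metric.mem_ball, dist_eq_norm] at ht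
    have := norm_le_norm_add_norm_sub' t t₀
    rw [Real.norm_eq_abs t₀] at this
    linarith
  · exact Continuous.integrable_of_hasCompactSupport (by fun_prop) hgc.norm.mul_right
  · have h1 : HasDerivAt (fun t : ℝ => (t : ℂ) * m ξ) (m ξ) t := by
      simpa using (Complex.ofRealCLM.hasDerivAt (x := t)).mul_const (m ξ)
    have h2 := (h1.cexp).const_mul (g ξ)
    convert! h2 using 1
    ring

theorem betaK_eq {k : ℝ} (hk : 0 ≤ k) (ξ : ℝ) :
    betaK k ξ = (√(k ^ 2 - ξ ^ 2) : ℝ) + Complex.I * (√(ξ ^ 2 - k ^ 2) : ℝ) := by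
  unfold betaK
  split_ifs with h
  · have : ξ ^ 2 ≤ k ^ 2 := sq_le_sq' (abs_le.1 h).1 (abs_le.1 h).2
    simp [Real.sqrt_eq_zero_of_nonpos (sub_nonpos.2 this)]
  · have : k ^ 2 ≤ ξ ^ 2 := by
      rw [← sq_abs ξ]
      gcongr
      exact (not_le.1 h).le
    simp [Real.sqrt_eq_zero_of_nonpos (sub_nonpos.2 this)]

theorem continuous_betaK {k : ℝ} (hk : 0 ≤ k) : Continuous (betaK k) := by
  rw [funext (betaK_eq hk)]
  fun_prop

theorem betaK_neg (k ξ : ℝ) : betaK k (-ξ) = betaK k ξ := by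
  simp [betaK]

theorem betaK_sq {k : ℝ} (hk : 0 ≤ k) (ξ : ℝ) : betaK k ξ ^ 2 = (k : ℂ) ^ 2 - (ξ : ℂ) ^ 2 := by
  rw [betaK_eq hk]
  rcases le_total (ξ ^ 2) (k ^ 2) with h | h
  · rw [Real.sqrt_eq_zero_of_nonpos (sub_nonpos.2 h), Complex.ofReal_zero, mul_zero, add_zero,
      ← Complex.ofReal_pow, Real.sq_sqrt (sub_nonneg.2 h)]
    push_cast
    ring
  · rw [Real.sqrt_eq_zero_of_nonpos (sub_nonpos.2 h), Complex.ofReal_zero, zero_add, mul_pow,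
      Complex.I_sq, ← Complex.ofReal_pow, Real.sq_sqrt (sub_nonneg.2 h)]
    push_cast
    ring

/-- A superposition of plane waves with wave vectors `(ξ, β(ξ))` and amplitude `a φ`. -/
noncomputable def waveIntegral (h : ℝ) (β φ a : ℝ → ℂ) (z : ℝ × ℝ) : ℂ :=
  ∫ ξ : ℝ, a ξ * Complex.exp (Complex.I * z.1 * ξ + Complex.I * (z.2 - h) * β ξ) * φ ξ

/-- The density of a plane wave superposition propagated over the vertical distance `τ`. -/
noncomputable def propagated (τ : ℝ) (β φ : ℝ → ℂ) (ξ : ℝ) : ℂ :=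
  Complex.exp (Complex.I * τ * β ξ) * φ ξ

section waveIntegral

variable {β φ a : ℝ → ℂ}

theorem continuous_propagated (hβ : Continuous β) (hφ : Continuous φ) (τ : ℝ) :
    Continuous (propagated τ β φ) := by
  unfold propagated
  fun_prop

theorem hasCompactSupport_propagated (hφ : HasCompactSupport φ) (τ : ℝ) :
    HasCompactSupport (propagated τ β φ) :=
  hφ.mul_left

theorem waveIntegral_eq_expIntegral (h x y : ℝ) :
    waveIntegral h β φ a (x, y) = expIntegral (fun ξ => a ξ * propagated (y - h) β φ ξ) x := by
  simp only [waveIntegral, expIntegral, propagated]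
  congr 1 with ξ
  rw [Complex.exp_add]
  push_cast
  ring

theorem hasDerivAt_waveIntegral_fst (hβ : Continuous β) (hφ : Continuous φ)
    (hφc : HasCompactSupport φ) (ha : Continuous a) (h x y : ℝ) :
    HasDerivAt (fun t => waveIntegral h β φ a (t, y))
      (waveIntegral h β φ (fun ξ => Complex.I * ξ * a ξ) (x, y)) x := by
  have H := hasDerivAt_integral_mul_cexp
    (g := fun ξ => a ξ * Complex.exp (Complex.I * (y - h) * β ξ) * φ ξ)
    (m := fun ξ : ℝ => Complex.I * ξ) (by fun_prop) hφc.mul_left (by fun_prop) x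
  convert! H using 1
  · ext t
    simp only [waveIntegral]
    congr 1 with ξ
    rw [Complex.exp_add]
    ring_nf
  · simp only [waveIntegral]
    congr 1 with ξ
    rw [Complex.exp_add]
    ring_nf

theorem hasDerivAt_waveIntegral_snd (hβ : Continuous β) (hφ : Continuous φ)
    (hφc : HasCompactSupport φ) (ha : Continuous a) (h x y : ℝ) :
    HasDerivAt (fun t => waveIntegral h β φ a (x, t))
      (waveIntegral h β φ (fun ξ => Complex.I * β ξ * a ξ) (x, y)) y := by
  have H := hasDerivAt_integral_mul_cexp
    (g := fun ξ => a ξ * Complex.exp (Complex.I * x * ξ - Complex.I * h * β ξ) * φ ξ)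
    (m := fun ξ : ℝ => Complex.I * β ξ) (by fun_prop) hφc.mul_left (by fun_prop) y
  have hexp : ∀ (t ξ : ℝ), Complex.exp (Complex.I * x * ξ + Complex.I * (t - h) * β ξ)
      = Complex.exp (Complex.I * x * ξ - Complex.I * h * β ξ)
        * Complex.exp (t * (Complex.I * β ξ)) := fun t ξ => by
    rw [← Complex.exp_add]
    ring_nf
  convert! H using 1
  · ext t
    simp only [waveIntegral, hexp]
    congr 1 with ξ
    ring
  · simp only [waveIntegral, hexp]
    congr 1 with ξ
    ring

end waveIntegral

section angField

variable {kp ks : ℝ} {φp φs : ℝ → ℂ}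

/-- The Fourier density on the line at height `τ` above `z₂ = h` of the superposition of a
compressional part with symbol `a` and a shear part with symbol `b`. -/
noncomputable def lineDensity (kp ks τ : ℝ) (φp φs a b : ℝ → ℂ) (ξ : ℝ) : ℂ :=
  a ξ * propagated τ (betaK kp) φp ξ + b ξ * propagated τ (betaK ks) φs ξ

theorem continuous_lineDensity (hkp : 0 ≤ kp) (hks : 0 ≤ ks) (hφp : Continuous φp)
    (hφs : Continuous φs) {a b : ℝ → ℂ} (ha : Continuous a) (hb : Continuous b) (τ : ℝ) :
    Continuous (lineDensity kp ks τ φp φs a b) :=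
  (ha.mul (continuous_propagated (continuous_betaK hkp) hφp τ)).add
    (hb.mul (continuous_propagated (continuous_betaK hks) hφs τ))

theorem hasCompactSupport_lineDensity (hφp : HasCompactSupport φp)
    (hφs : HasCompactSupport φs) (a b : ℝ → ℂ) (τ : ℝ) :
    HasCompactSupport (lineDensity kp ks τ φp φs a b) :=
  hasCompactSupport_linearCombination (hasCompactSupport_propagated hφp τ)
    (hasCompactSupport_propagated hφs τ) a b

/-- The symbol of the compressional part of the `j`-th component of `angField`. -/
noncomputable def symbolP (kp : ℝ) (j : Fin 2) (ξ : ℝ) : ℂ := ![(ξ : ℂ), betaK kp ξ] j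

/-- The symbol of the shear part of the `j`-th component of `angField`. -/
noncomputable def symbolS (ks : ℝ) (j : Fin 2) (ξ : ℝ) : ℂ := ![betaK ks ξ, -(ξ : ℂ)] j

theorem continuous_symbolP (hkp : 0 ≤ kp) (j : Fin 2) : Continuous (symbolP kp j) := by
  have := continuous_betaK hkp
  fin_cases j
  · exact Complex.continuous_ofReal
  · exact this

theorem continuous_symbolS (hks : 0 ≤ ks) (j : Fin 2) : Continuous (symbolS ks j) := by
  have := continuous_betaK hks
  fin_cases j
  · exact this
  · exact Complex.continuous_ofReal.neg

theorem angField_eq_waveIntegral (h : ℝ) (z : ℝ × ℝ) (j : Fin 2) :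
    angField kp ks h φp φs z j = Complex.I / (2 * (π : ℂ)) *
      (waveIntegral h (betaK kp) φp (symbolP kp j) z
        + waveIntegral h (betaK ks) φs (symbolS ks j) z) :=
  rfl

variable (hkp : 0 ≤ kp) (hks : 0 ≤ ks) (hφp : Continuous φp) (hφpc : HasCompactSupport φp)
  (hφs : Continuous φs) (hφsc : HasCompactSupport φs)
include hkp hks hφp hφpc hφs hφsc

theorem waveIntegral_add_waveIntegral {a b : ℝ → ℂ} (ha : Continuous a) (hb : Continuous b)
    (h x y : ℝ) :
    waveIntegral h (betaK kp) φp a (x, y) + waveIntegral h (betaK ks) φs b (x, y)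
      = expIntegral (lineDensity kp ks (y - h) φp φs a b) x := by
  have H := expIntegral_linearCombination
    (f := fun ξ => a ξ * propagated (y - h) (betaK kp) φp ξ)
    (g := fun ξ => b ξ * propagated (y - h) (betaK ks) φs ξ)
    (ha.mul (continuous_propagated (continuous_betaK hkp) hφp _))
    (hasCompactSupport_propagated hφpc _).mul_left
    (hb.mul (continuous_propagated (continuous_betaK hks) hφs _))
    (hasCompactSupport_propagated hφsc _).mul_left 1 1 x
  simp only [one_mul] at H
  rw [waveIntegral_eq_expIntegral, waveIntegral_eq_expIntegral, ← H]
  rfl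

theorem angField_eq_expIntegral (h x y : ℝ) (j : Fin 2) :
    angField kp ks h φp φs (x, y) j = Complex.I / (2 * (π : ℂ)) *
      expIntegral (lineDensity kp ks (y - h) φp φs (symbolP kp j) (symbolS ks j)) x := by
  rw [angField_eq_waveIntegral, waveIntegral_add_waveIntegral hkp hks hφp hφpc hφs hφsc
    (continuous_symbolP hkp j) (continuous_symbolS hks j)]

theorem pd1_angField (h x y : ℝ) (j : Fin 2) :
    pd1 (fun w => angField kp ks h φp φs w j) (x, y) = Complex.I / (2 * (π : ℂ)) *
      expIntegral (lineDensity kp ks (y - h) φp φs (fun ξ => Complex.I * ξ * symbolP kp j ξ)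
        (fun ξ => Complex.I * ξ * symbolS ks j ξ)) x := by
  have hp := continuous_symbolP hkp j
  have hs := continuous_symbolS hks j
  rw [← waveIntegral_add_waveIntegral hkp hks hφp hφpc hφs hφsc (by fun_prop) (by fun_prop)]
  exact (((hasDerivAt_waveIntegral_fst (continuous_betaK hkp) hφp hφpc hp h x y).add
    (hasDerivAt_waveIntegral_fst (continuous_betaK hks) hφs hφsc hs h x y)).const_mul _).deriv

theorem pd2_angField (h x y : ℝ) (j : Fin 2) :
    pd2 (fun w => angField kp ks h φp φs w j) (x, y) = Complex.I / (2 * (π : ℂ)) *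
      expIntegral (lineDensity kp ks (y - h) φp φs
        (fun ξ => Complex.I * betaK kp ξ * symbolP kp j ξ)
        (fun ξ => Complex.I * betaK ks ξ * symbolS ks j ξ)) x := by
  have hp := continuous_symbolP hkp j
  have hs := continuous_symbolS hks j
  have hβp := continuous_betaK hkp
  have hβs := continuous_betaK hks
  rw [← waveIntegral_add_waveIntegral hkp hks hφp hφpc hφs hφsc (by fun_prop) (by fun_prop)]
  exact (((hasDerivAt_waveIntegral_snd hβp hφp hφpc hp h x y).add
    (hasDerivAt_waveIntegral_snd hβs hφs hφsc hs h x y)).const_mul _).deriv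

end angField

/-- The compressional symbol of the generalized stress, with normal `(0, 1)`, of `angField`. -/
noncomputable def stressSymbolP (μ lam μt lamt kp : ℝ) (j : Fin 2) (ξ : ℝ) : ℂ :=
  Complex.I * ![(μ + μt) * ξ * betaK kp ξ, (2 * μ + lam) * betaK kp ξ ^ 2 + lamt * ξ ^ 2] j

/-- The shear symbol of the generalized stress, with normal `(0, 1)`, of `angField`. -/
noncomputable def stressSymbolS (μ lam μt lamt ks : ℝ) (j : Fin 2) (ξ : ℝ) : ℂ :=
  Complex.I * ![μ * betaK ks ξ ^ 2 - μt * ξ ^ 2, (lamt - (2 * μ + lam)) * ξ * betaK ks ξ] j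

section stress

variable {μ lam μt lamt kp ks : ℝ} {φp φs : ℝ → ℂ}

theorem continuous_stressSymbolP (hkp : 0 ≤ kp) (j : Fin 2) :
    Continuous (stressSymbolP μ lam μt lamt kp j) := by
  have := continuous_betaK hkp
  unfold stressSymbolP
  fin_cases j <;> simp <;> fun_prop

theorem continuous_stressSymbolS (hks : 0 ≤ ks) (j : Fin 2) :
    Continuous (stressSymbolS μ lam μt lamt ks j) := by
  have := continuous_betaK hks
  unfold stressSymbolS
  fin_cases j <;> simp <;> fun_prop

theorem Pstress_angField (hμt : μt + lamt = μ + lam) (hkp : 0 ≤ kp) (hks : 0 ≤ ks)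
    (hφp : Continuous φp) (hφpc : HasCompactSupport φp) (hφs : Continuous φs)
    (hφsc : HasCompactSupport φs) (h x y : ℝ) (j : Fin 2) :
    Pstress μ μt lamt (0, 1) (angField kp ks h φp φs) (x, y) j = Complex.I / (2 * (π : ℂ)) *
      expIntegral (lineDensity kp ks (y - h) φp φs (stressSymbolP μ lam μt lamt kp j)
        (stressSymbolS μ lam μt lamt ks j)) x := by
  have hμt' : (μt : ℂ) + lamt = μ + lam := by exact_mod_cast hμt
  have hβp := continuous_betaK hkp
  have hβs := continuous_betaK hks
  have hp := continuous_symbolP hkp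
  have hs := continuous_symbolS hks
  have key (A B : ℂ) (i j : Fin 2) := expIntegral_linearCombination
    (f := lineDensity kp ks (y - h) φp φs (fun ξ => Complex.I * betaK kp ξ * symbolP kp i ξ)
        (fun ξ => Complex.I * betaK ks ξ * symbolS ks i ξ))
    (g := lineDensity kp ks (y - h) φp φs (fun ξ => Complex.I * ξ * symbolP kp j ξ)
        (fun ξ => Complex.I * ξ * symbolS ks j ξ))
    (continuous_lineDensity hkp hks hφp hφs (by fun_prop) (by fun_prop) _)
    (hasCompactSupport_lineDensity hφpc hφsc _ _ _)
    (continuous_lineDensity hkp hks hφp hφs (by fun_prop) (by fun_prop) _)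
    (hasCompactSupport_lineDensity hφpc hφsc _ _ _) A B x
  have hpd1 := pd1_angField hkp hks hφp hφpc hφs hφsc h x y
  have hpd2 := pd2_angField hkp hks hφp hφpc hφs hφsc h x y
  fin_cases j
  · have e : Pstress μ μt lamt (0, 1) (angField kp ks h φp φs) (x, y) 0
        = μ * pd2 (fun w => angField kp ks h φp φs w 0) (x, y)
          + μt * pd1 (fun w => angField kp ks h φp φs w 1) (x, y) := by
      simp [Pstress]
      ring
    rw [Fin.zero_eta, e, hpd1, hpd2, mul_left_comm, mul_left_comm (μt : ℂ), ← mul_add, ← key]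
    congr 2
    ext ξ
    simp [lineDensity, stressSymbolP, stressSymbolS, symbolP, symbolS]
    ring
  · have e : Pstress μ μt lamt (0, 1) (angField kp ks h φp φs) (x, y) 1
        = (2 * μ + lam) * pd2 (fun w => angField kp ks h φp φs w 1) (x, y)
          + lamt * pd1 (fun w => angField kp ks h φp φs w 0) (x, y) := by
      simp [Pstress]
      linear_combination pd2 (fun w => angField kp ks h φp φs w 1) (x, y) * hμt'
    rw [Fin.mk_one, e, hpd1, hpd2, mul_left_comm, mul_left_comm (lamt : ℂ), ← mul_add, ← key]
    congr 2
    ext ξ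
    simp [lineDensity, stressSymbolP, stressSymbolS, symbolP, symbolS]
    ring

/-- The algebraic symmetry of the symbols of the stress and of the field. -/
theorem stress_field_symbol_symm (hkp : 0 ≤ kp) (hks : 0 ≤ ks)
    (hμt : μt + lamt = μ + lam) (hk : (2 * μ + lam) * kp ^ 2 = μ * ks ^ 2)
    (τ ξ : ℝ) (φp φs ψp ψs : ℝ → ℂ) :
    lineDensity kp ks τ φp φs (stressSymbolP μ lam μt lamt kp 0)
          (stressSymbolS μ lam μt lamt ks 0) ξ
        * lineDensity kp ks τ ψp ψs (symbolP kp 0) (symbolS ks 0) (-ξ)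
      + lineDensity kp ks τ φp φs (stressSymbolP μ lam μt lamt kp 1)
          (stressSymbolS μ lam μt lamt ks 1) ξ
        * lineDensity kp ks τ ψp ψs (symbolP kp 1) (symbolS ks 1) (-ξ)
    = lineDensity kp ks τ φp φs (symbolP kp 0) (symbolS ks 0) ξ
        * lineDensity kp ks τ ψp ψs (stressSymbolP μ lam μt lamt kp 0)
          (stressSymbolS μ lam μt lamt ks 0) (-ξ)
      + lineDensity kp ks τ φp φs (symbolP kp 1) (symbolS ks 1) ξ
        * lineDensity kp ks τ ψp ψs (stressSymbolP μ lam μt lamt kp 1)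
          (stressSymbolS μ lam μt lamt ks 1) (-ξ) := by
  have hμt' : (μt : ℂ) + lamt = μ + lam := by exact_mod_cast hμt
  have hk' : (2 * μ + lam : ℂ) * kp ^ 2 = μ * ks ^ 2 := by exact_mod_cast hk
  have hp := betaK_sq hkp ξ
  have hs := betaK_sq hks ξ
  simp only [lineDensity, stressSymbolP, stressSymbolS, symbolP, symbolS, Matrix.cons_val_zero,
    Matrix.cons_val_one, betaK_neg, Complex.ofReal_neg, neg_sq, neg_neg]
  generalize propagated τ (betaK kp) φp ξ = p
  generalize propagated τ (betaK ks) φs ξ = s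
  generalize propagated τ (betaK kp) ψp (-ξ) = p'
  generalize propagated τ (betaK ks) ψs (-ξ) = s'
  generalize betaK kp ξ = β at *
  generalize betaK ks ξ = γ at *
  linear_combination Complex.I * ξ * (p * s' + s * p') *
    ((2 * μ + lam) * hp - μ * hs + hk' + (ξ ^ 2 + β * γ) * hμt')

end stress

/-- for angular-spectrum fields `u = u[φ_p,φ_s]`, `v = u[ψ_p,ψ_s]` with
compactly supported continuous densities and `b > h`, the function
`z₁ ↦ (Pu)(z₁,b)·v(z₁,b) − (Pv)(z₁,b)·u(z₁,b)` (normal `n = (0,1)`) is integrable on `ℝ`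
and its integral vanishes. -/
theorem statement1 (μ lam μt lamt ω kp ks h b : ℝ)
    (hμ : 0 < μ) (hlam : 0 ≤ lam + μ) (hω : 0 < ω)
    (hμt : μt + lamt = μ + lam)
    (hkp : kp = ω / Real.sqrt (2 * μ + lam)) (hks : ks = ω / Real.sqrt μ)
    (hb : h < b)
    (φp φs ψp ψs : ℝ → ℂ)
    (hφp : Continuous φp) (hφpc : HasCompactSupport φp)
    (hφs : Continuous φs) (hφsc : HasCompactSupport φs)
    (hψp : Continuous ψp) (hψpc : HasCompactSupport ψp)
    (hψs : Continuous ψs) (hψsc : HasCompactSupport ψs) :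
    MeasureTheory.Integrable (fun z₁ : ℝ =>
        dotC (Pstress μ μt lamt (0, 1) (angField kp ks h φp φs) (z₁, b))
            (angField kp ks h ψp ψs (z₁, b))
          - dotC (Pstress μ μt lamt (0, 1) (angField kp ks h ψp ψs) (z₁, b))
            (angField kp ks h φp φs (z₁, b))) ∧
      (∫ z₁ : ℝ,
        (dotC (Pstress μ μt lamt (0, 1) (angField kp ks h φp φs) (z₁, b))
            (angField kp ks h ψp ψs (z₁, b))
          - dotC (Pstress μ μt lamt (0, 1) (angField kp ks h ψp ψs) (z₁, b))
            (angField kp ks h φp φs (z₁, b)))) = 0 := by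
  have hkp0 : 0 ≤ kp := by rw [hkp]; positivity
  have hks0 : 0 ≤ ks := by rw [hks]; positivity
  have hk : (2 * μ + lam) * kp ^ 2 = μ * ks ^ 2 := by
    have h1 : 0 < 2 * μ + lam := by linarith
    rw [hkp, hks, div_pow, div_pow, Real.sq_sqrt h1.le, Real.sq_sqrt hμ.le,
      mul_div_cancel₀ _ h1.ne', mul_div_cancel₀ _ hμ.ne']
  let U (j : Fin 2) (φ φ' : ℝ → ℂ) :=
    lineDensity kp ks (b - h) φ φ' (symbolP kp j) (symbolS ks j)
  let T (j : Fin 2) (φ φ' : ℝ → ℂ) := lineDensity kp ks (b - h) φ φ'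
    (stressSymbolP μ lam μt lamt kp j) (stressSymbolS μ lam μt lamt ks j)
  obtain ⟨hint, hzero⟩ := integral_expIntegral_antisymm
    (f := ![T 0 φp φs, T 1 φp φs, U 0 φp φs, U 1 φp φs])
    (g := ![U 0 ψp ψs, U 1 ψp ψs, T 0 ψp ψs, T 1 ψp ψs])
    (fun i => by
      fin_cases i <;> exact continuous_lineDensity hkp0 hks0 hφp hφs
        (by first | exact continuous_stressSymbolP hkp0 _ | exact continuous_symbolP hkp0 _)
        (by first | exact continuous_stressSymbolS hks0 _ | exact continuous_symbolS hks0 _) _)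
    (fun i => by fin_cases i <;> exact hasCompactSupport_lineDensity hφpc hφsc _ _ _)
    (fun i => by
      fin_cases i <;> exact continuous_lineDensity hkp0 hks0 hψp hψs
        (by first | exact continuous_stressSymbolP hkp0 _ | exact continuous_symbolP hkp0 _)
        (by first | exact continuous_stressSymbolS hks0 _ | exact continuous_symbolS hks0 _) _)
    (fun i => by fin_cases i <;> exact hasCompactSupport_lineDensity hψpc hψsc _ _ _)
    (fun ξ => stress_field_symbol_symm hkp0 hks0 hμt hk (b - h) ξ φp φs ψp ψs)
  have heq : (fun z₁ : ℝ =>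
        dotC (Pstress μ μt lamt (0, 1) (angField kp ks h φp φs) (z₁, b))
            (angField kp ks h ψp ψs (z₁, b))
          - dotC (Pstress μ μt lamt (0, 1) (angField kp ks h ψp ψs) (z₁, b))
            (angField kp ks h φp φs (z₁, b))) = fun x => (Complex.I / (2 * (π : ℂ))) ^ 2 *
      ((expIntegral (T 0 φp φs) x * expIntegral (U 0 ψp ψs) x
        + expIntegral (T 1 φp φs) x * expIntegral (U 1 ψp ψs) x)
        - (expIntegral (U 0 φp φs) x * expIntegral (T 0 ψp ψs) x
        + expIntegral (U 1 φp φs) x * expIntegral (T 1 ψp ψs) x)) := by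
    ext x
    simp only [dotC, Pstress_angField hμt hkp0 hks0 hφp hφpc hφs hφsc,
      Pstress_angField hμt hkp0 hks0 hψp hψpc hψs hψsc,
      angField_eq_expIntegral hkp0 hks0 hφp hφpc hφs hφsc,
      angField_eq_expIntegral hkp0 hks0 hψp hψpc hψs hψsc, U, T]
    ring
  rw [heq]
  refine ⟨hint.const_mul _, ?_⟩
  rw [integral_const_mul]
  exact mul_eq_zero_of_right _ hzero
end

section
/- Let θ₁ ≤ θ₂ be real numbers and q ∈ ℂ². Define U : ℝ² → ℂ² by U(x) := ∫_{θ₁}^{θ₂} [ (1/(λ+2μ)) (d(θ)·q) d(θ) e^{i k_p x·d(θ)} + (1/μ) ( q − (d(θ)·q) d(θ) ) e^{i k_s x·d(θ)} ] dθ. Then U is smooth on ℝ² and satisfies the Navier equation μ ΔU + (λ+μ) ∇(div U) + ω² U = 0 on all of ℝ². -/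
open Complex MeasureTheory Real Filter

noncomputable section

/-- Divergence of a planar vector field. -/
def divC (u : ℝ × ℝ → Fin 2 → ℂ) (z : ℝ × ℝ) : ℂ :=
  pd1 (fun w => u w 0) z + pd2 (fun w => u w 1) z

/-- The Navier equation `μ Δu + (λ+μ) ∇(div u) + ω² u = 0` holds at the point `z`. -/
def navierAt (μ lam ω : ℝ) (u : ℝ × ℝ → Fin 2 → ℂ) (z : ℝ × ℝ) : Prop :=
  ∀ j : Fin 2,
    (μ : ℂ) * (pd1 (pd1 (fun w => u w j)) z + pd2 (pd2 (fun w => u w j)) z)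
      + ((lam + μ : ℝ) : ℂ) * (![pd1 (fun w => divC u w), pd2 (fun w => divC u w)] j z)
      + ((ω : ℝ) : ℂ) ^ 2 * u z j = 0

end

noncomputable section

/-- The direction vector `d(θ) = (cos θ, sin θ)` as a complex vector. -/
def dvecC (θ : ℝ) : Fin 2 → ℂ := ![((Real.cos θ : ℝ) : ℂ), ((Real.sin θ : ℝ) : ℂ)]

/-- The Herglotz-type field
`U(x) = ∫_{θ₁}^{θ₂} [(1/(λ+2μ)) (d·q) d e^{i k_p x·d} + (1/μ)(q − (d·q) d) e^{i k_s x·d}] dθ`. -/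
def herglotzU (μ lam kp ks θ₁ θ₂ : ℝ) (q : Fin 2 → ℂ) (x : ℝ × ℝ) : Fin 2 → ℂ :=
  fun j => ∫ θ in θ₁..θ₂,
    ((1 / ((lam : ℂ) + 2 * μ)) * (dvecC θ 0 * q 0 + dvecC θ 1 * q 1) * dvecC θ j *
        Complex.exp (Complex.I * kp * (x.1 * Real.cos θ + x.2 * Real.sin θ))
      + (1 / (μ : ℂ)) * (q j - (dvecC θ 0 * q 0 + dvecC θ 1 * q 1) * dvecC θ j) *
        Complex.exp (Complex.I * ks * (x.1 * Real.cos θ + x.2 * Real.sin θ)))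

end

noncomputable section

/-- The superposition `∫_{θ₁}^{θ₂} a(θ) e^{i k x·d(θ)} dθ` of plane waves of wave number `k` with
density `a`. -/
def planeWaveIntegral (θ₁ θ₂ k : ℝ) (a : ℝ → ℂ) (x : ℝ × ℝ) : ℂ :=
  ∫ θ in θ₁..θ₂, a θ *
    Complex.exp (Complex.I * k * (x.1 * Real.cos θ + x.2 * Real.sin θ))

end

theorem norm_exp_planeWave (k θ : ℝ) (x : ℝ × ℝ) :
    ‖Complex.exp (Complex.I * k * (x.1 * Real.cos θ + x.2 * Real.sin θ))‖ = 1 := by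
  rw [Complex.norm_exp]
  simp [-Complex.ofReal_cos, -Complex.ofReal_sin]

theorem continuous_planeWave_integrand (k : ℝ) {a : ℝ → ℂ} (ha : Continuous a) (x : ℝ × ℝ) :
    Continuous fun θ : ℝ => a θ *
      Complex.exp (Complex.I * k * (x.1 * Real.cos θ + x.2 * Real.sin θ)) := by
  fun_prop

theorem hasFDerivAt_planeWave_integrand (k θ : ℝ) (c : ℂ) (x : ℝ × ℝ) :
    HasFDerivAt (fun y : ℝ × ℝ => c *
        Complex.exp (Complex.I * k * (y.1 * Real.cos θ + y.2 * Real.sin θ)))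
      ((Complex.I * k * Real.cos θ * c *
          Complex.exp (Complex.I * k * (x.1 * Real.cos θ + x.2 * Real.sin θ))) •
          Complex.ofRealCLM.comp (ContinuousLinearMap.fst ℝ ℝ ℝ) +
        (Complex.I * k * Real.sin θ * c *
          Complex.exp (Complex.I * k * (x.1 * Real.cos θ + x.2 * Real.sin θ))) •
          Complex.ofRealCLM.comp (ContinuousLinearMap.snd ℝ ℝ ℝ)) x := by
  have h1 : HasFDerivAt (fun y : ℝ × ℝ => (y.1 : ℂ))
      (Complex.ofRealCLM.comp (ContinuousLinearMap.fst ℝ ℝ ℝ)) x :=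
    (Complex.ofRealCLM.comp (ContinuousLinearMap.fst ℝ ℝ ℝ)).hasFDerivAt
  have h2 : HasFDerivAt (fun y : ℝ × ℝ => (y.2 : ℂ))
      (Complex.ofRealCLM.comp (ContinuousLinearMap.snd ℝ ℝ ℝ)) x :=
    (Complex.ofRealCLM.comp (ContinuousLinearMap.snd ℝ ℝ ℝ)).hasFDerivAt
  refine (((((h1.mul_const (Real.cos θ : ℂ)).add (h2.mul_const (Real.sin θ : ℂ))).const_mul
    (Complex.I * k)).cexp).const_mul c).congr_fderiv ?_
  ext <;> simp [-Complex.ofReal_cos, -Complex.ofReal_sin] <;> ring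

theorem hasFDerivAt_planeWaveIntegral (θ₁ θ₂ k : ℝ) {a : ℝ → ℂ} (ha : Continuous a)
    (x : ℝ × ℝ) :
    HasFDerivAt (planeWaveIntegral θ₁ θ₂ k a)
      (planeWaveIntegral θ₁ θ₂ k (fun θ => Complex.I * k * Real.cos θ * a θ) x •
          Complex.ofRealCLM.comp (ContinuousLinearMap.fst ℝ ℝ ℝ) +
        planeWaveIntegral θ₁ θ₂ k (fun θ => Complex.I * k * Real.sin θ * a θ) x •
          Complex.ofRealCLM.comp (ContinuousLinearMap.snd ℝ ℝ ℝ)) x := by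
  have hc : Continuous fun θ : ℝ => Complex.I * k * Real.cos θ * a θ := by fun_prop
  have hs : Continuous fun θ : ℝ => Complex.I * k * Real.sin θ * a θ := by fun_prop
  have hcx := continuous_planeWave_integrand k hc x
  have hsx := continuous_planeWave_integrand k hs x
  set C₁ : ℝ × ℝ →L[ℝ] ℂ := Complex.ofRealCLM.comp (ContinuousLinearMap.fst ℝ ℝ ℝ)
  set C₂ : ℝ × ℝ →L[ℝ] ℂ := Complex.ofRealCLM.comp (ContinuousLinearMap.snd ℝ ℝ ℝ)
  have hc' : Continuous fun θ : ℝ => (Complex.I * k * Real.cos θ * a θ *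
      Complex.exp (Complex.I * k * (x.1 * Real.cos θ + x.2 * Real.sin θ))) • C₁ :=
    hcx.smul continuous_const
  have hs' : Continuous fun θ : ℝ => (Complex.I * k * Real.sin θ * a θ *
      Complex.exp (Complex.I * k * (x.1 * Real.cos θ + x.2 * Real.sin θ))) • C₂ :=
    hsx.smul continuous_const
  have key := intervalIntegral.hasFDerivAt_integral_of_dominated_of_fderiv_le (𝕜 := ℝ)
    (μ := volume) (a := θ₁) (b := θ₂) (x₀ := x) (s := Set.univ)
    (bound := fun θ => ‖Complex.I * k * Real.cos θ * a θ‖ * ‖C₁‖ +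
      ‖Complex.I * k * Real.sin θ * a θ‖ * ‖C₂‖)
    Filter.univ_mem
    (Filter.Eventually.of_forall fun y =>
      (continuous_planeWave_integrand k ha y).aestronglyMeasurable)
    ((continuous_planeWave_integrand k ha x).intervalIntegrable _ _)
    (hc'.add hs').aestronglyMeasurable
    (ae_of_all _ fun θ _ y _ => (norm_add_le _ _).trans_eq (by
      rw [norm_smul, norm_smul, norm_mul _ (Complex.exp _), norm_mul _ (Complex.exp _),
        norm_exp_planeWave, mul_one, mul_one]))
    (((hc.norm.mul continuous_const).add (hs.norm.mul continuous_const)).intervalIntegrable _ _)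
    (ae_of_all _ fun θ _ y _ => hasFDerivAt_planeWave_integrand k θ (a θ) y)
  refine key.congr_fderiv ?_
  rw [intervalIntegral.integral_add (hc'.intervalIntegrable _ _) (hs'.intervalIntegrable _ _),
    intervalIntegral.integral_smul_const, intervalIntegral.integral_smul_const]
  simp only [planeWaveIntegral, C₁, C₂]

theorem contDiff_planeWaveIntegral (θ₁ θ₂ k : ℝ) {a : ℝ → ℂ} (ha : Continuous a) :
    ContDiff ℝ (⊤ : ℕ∞) (planeWaveIntegral θ₁ θ₂ k a) := by
  rw [contDiff_infty]
  intro n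
  induction n generalizing a with
  | zero =>
    exact contDiff_zero.2 (continuous_iff_continuousAt.2 fun x =>
      (hasFDerivAt_planeWaveIntegral θ₁ θ₂ k ha x).continuousAt)
  | succ n ih =>
    exact contDiff_succ_iff_hasFDerivAt.2 ⟨_,
      ((ih (by fun_prop)).smul contDiff_const).add ((ih (by fun_prop)).smul contDiff_const),
      hasFDerivAt_planeWaveIntegral θ₁ θ₂ k ha⟩

noncomputable section

/-- The superposition of plane waves of two wave numbers, with densities `a` and `b`. -/
def twoWaveIntegral (θ₁ θ₂ kp ks : ℝ) (a b : ℝ → ℂ) (x : ℝ × ℝ) : ℂ :=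
  planeWaveIntegral θ₁ θ₂ kp a x + planeWaveIntegral θ₁ θ₂ ks b x

end

theorem pd1_twoWaveIntegral (θ₁ θ₂ kp ks : ℝ) {a b : ℝ → ℂ} (ha : Continuous a)
    (hb : Continuous b) :
    pd1 (twoWaveIntegral θ₁ θ₂ kp ks a b) = twoWaveIntegral θ₁ θ₂ kp ks
      (fun θ => Complex.I * kp * Real.cos θ * a θ)
      (fun θ => Complex.I * ks * Real.cos θ * b θ) := by
  funext z
  have h := ((hasFDerivAt_planeWaveIntegral θ₁ θ₂ kp ha z).add
    (hasFDerivAt_planeWaveIntegral θ₁ θ₂ ks hb z)).comp_hasDerivAt z.1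
    ((hasDerivAt_id z.1).prodMk (hasDerivAt_const z.1 z.2))
  refine h.deriv.trans ?_
  simp [twoWaveIntegral]

theorem pd2_twoWaveIntegral (θ₁ θ₂ kp ks : ℝ) {a b : ℝ → ℂ} (ha : Continuous a)
    (hb : Continuous b) :
    pd2 (twoWaveIntegral θ₁ θ₂ kp ks a b) = twoWaveIntegral θ₁ θ₂ kp ks
      (fun θ => Complex.I * kp * Real.sin θ * a θ)
      (fun θ => Complex.I * ks * Real.sin θ * b θ) := by
  funext z
  have h := ((hasFDerivAt_planeWaveIntegral θ₁ θ₂ kp ha z).add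
    (hasFDerivAt_planeWaveIntegral θ₁ θ₂ ks hb z)).comp_hasDerivAt z.2
    ((hasDerivAt_const z.2 z.1).prodMk (hasDerivAt_id z.2))
  refine h.deriv.trans ?_
  simp [twoWaveIntegral]

theorem planeWaveIntegral_add (θ₁ θ₂ k : ℝ) {a b : ℝ → ℂ} (ha : Continuous a)
    (hb : Continuous b) (x : ℝ × ℝ) :
    planeWaveIntegral θ₁ θ₂ k a x + planeWaveIntegral θ₁ θ₂ k b x =
      planeWaveIntegral θ₁ θ₂ k (fun θ => a θ + b θ) x := by
  simp only [planeWaveIntegral, add_mul]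
  exact (intervalIntegral.integral_add
    ((continuous_planeWave_integrand k ha x).intervalIntegrable _ _)
    ((continuous_planeWave_integrand k hb x).intervalIntegrable _ _)).symm

theorem twoWaveIntegral_add (θ₁ θ₂ kp ks : ℝ) {a b a' b' : ℝ → ℂ} (ha : Continuous a)
    (hb : Continuous b) (ha' : Continuous a') (hb' : Continuous b') (x : ℝ × ℝ) :
    twoWaveIntegral θ₁ θ₂ kp ks a b x + twoWaveIntegral θ₁ θ₂ kp ks a' b' x =
      twoWaveIntegral θ₁ θ₂ kp ks (fun θ => a θ + a' θ) (fun θ => b θ + b' θ) x := by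
  simp only [twoWaveIntegral, ← planeWaveIntegral_add θ₁ θ₂ _ ha ha',
    ← planeWaveIntegral_add θ₁ θ₂ _ hb hb']
  ring

theorem const_mul_twoWaveIntegral (θ₁ θ₂ kp ks : ℝ) (c : ℂ) (a b : ℝ → ℂ) (x : ℝ × ℝ) :
    c * twoWaveIntegral θ₁ θ₂ kp ks a b x =
      twoWaveIntegral θ₁ θ₂ kp ks (fun θ => c * a θ) (fun θ => c * b θ) x := by
  simp only [twoWaveIntegral, planeWaveIntegral, mul_add, mul_assoc,
    intervalIntegral.integral_const_mul]

theorem continuous_dvecC (j : Fin 2) : Continuous fun θ => dvecC θ j := by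
  fin_cases j
  · exact Complex.continuous_ofReal.comp Real.continuous_cos
  · exact Complex.continuous_ofReal.comp Real.continuous_sin

/-- The Navier equation for a superposition of plane waves reduces to an algebraic identity
between the densities. -/
theorem navierAt_twoWaveIntegral {μ lam ω θ₁ θ₂ kp ks : ℝ} {a b : Fin 2 → ℝ → ℂ}
    (ha : ∀ j, Continuous (a j)) (hb : ∀ j, Continuous (b j))
    (hp : ∀ j θ, (ω : ℂ) ^ 2 * a j θ = (kp : ℂ) ^ 2 * (μ * a j θ +
      (lam + μ) * dvecC θ j * (Real.cos θ * a 0 θ + Real.sin θ * a 1 θ)))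
    (hs : ∀ j θ, (ω : ℂ) ^ 2 * b j θ = (ks : ℂ) ^ 2 * (μ * b j θ +
      (lam + μ) * dvecC θ j * (Real.cos θ * b 0 θ + Real.sin θ * b 1 θ)))
    (z : ℝ × ℝ) :
    navierAt μ lam ω (fun x j => twoWaveIntegral θ₁ θ₂ kp ks (a j) (b j) x) z := by
  have hdiv : (fun w => divC (fun x j => twoWaveIntegral θ₁ θ₂ kp ks (a j) (b j) x) w) =
      twoWaveIntegral θ₁ θ₂ kp ks
        (fun θ => Complex.I * kp * Real.cos θ * a 0 θ + Complex.I * kp * Real.sin θ * a 1 θ)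
        (fun θ => Complex.I * ks * Real.cos θ * b 0 θ + Complex.I * ks * Real.sin θ * b 1 θ) := by
    funext w
    have ha0 := ha 0
    have ha1 := ha 1
    have hb0 := hb 0
    have hb1 := hb 1
    rw [← twoWaveIntegral_add _ _ _ _ (by fun_prop) (by fun_prop) (by fun_prop) (by fun_prop),
      ← pd1_twoWaveIntegral _ _ _ _ ha0 hb0, ← pd2_twoWaveIntegral _ _ _ _ ha1 hb1]
    rfl
  have hgrad : ∀ j : Fin 2,
      (![pd1 (fun w => divC (fun x j => twoWaveIntegral θ₁ θ₂ kp ks (a j) (b j) x) w),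
        pd2 (fun w => divC (fun x j => twoWaveIntegral θ₁ θ₂ kp ks (a j) (b j) x) w)] j z) =
      twoWaveIntegral θ₁ θ₂ kp ks
        (fun θ => Complex.I * kp * dvecC θ j *
          (Complex.I * kp * Real.cos θ * a 0 θ + Complex.I * kp * Real.sin θ * a 1 θ))
        (fun θ => Complex.I * ks * dvecC θ j *
          (Complex.I * ks * Real.cos θ * b 0 θ + Complex.I * ks * Real.sin θ * b 1 θ)) z := by
    have ha0 := ha 0
    have ha1 := ha 1
    have hb0 := hb 0
    have hb1 := hb 1
    rw [hdiv, pd1_twoWaveIntegral _ _ _ _ (by fun_prop) (by fun_prop),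
      pd2_twoWaveIntegral _ _ _ _ (by fun_prop) (by fun_prop)]
    intro j
    fin_cases j <;> rfl
  intro j
  have ha0 := ha 0
  have ha1 := ha 1
  have hb0 := hb 0
  have hb1 := hb 1
  have haj := ha j
  have hbj := hb j
  have hdj := continuous_dvecC j
  rw [hgrad j]
  change (μ : ℂ) * (pd1 (pd1 (twoWaveIntegral θ₁ θ₂ kp ks (a j) (b j))) z +
    pd2 (pd2 (twoWaveIntegral θ₁ θ₂ kp ks (a j) (b j))) z) + _ +
    _ * twoWaveIntegral θ₁ θ₂ kp ks (a j) (b j) z = 0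
  rw [pd1_twoWaveIntegral _ _ _ _ haj hbj, pd2_twoWaveIntegral _ _ _ _ haj hbj,
    pd1_twoWaveIntegral _ _ _ _ (by fun_prop) (by fun_prop),
    pd2_twoWaveIntegral _ _ _ _ (by fun_prop) (by fun_prop),
    twoWaveIntegral_add _ _ _ _ (by fun_prop) (by fun_prop) (by fun_prop) (by fun_prop),
    const_mul_twoWaveIntegral, const_mul_twoWaveIntegral, const_mul_twoWaveIntegral,
    twoWaveIntegral_add _ _ _ _ (by fun_prop) (by fun_prop) (by fun_prop) (by fun_prop),
    twoWaveIntegral_add _ _ _ _ (by fun_prop) (by fun_prop) (by fun_prop) (by fun_prop)]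
  have hcs : ∀ θ : ℝ, (Real.cos θ : ℂ) ^ 2 + (Real.sin θ : ℂ) ^ 2 = 1 := fun θ => by
    exact_mod_cast Real.cos_sq_add_sin_sq θ
  have hzero : ∀ k : ℝ, ∀ c : Fin 2 → ℝ → ℂ, (∀ θ, (ω : ℂ) ^ 2 * c j θ = (k : ℂ) ^ 2 *
      (μ * c j θ + (lam + μ) * dvecC θ j * (Real.cos θ * c 0 θ + Real.sin θ * c 1 θ))) →
      planeWaveIntegral θ₁ θ₂ k (fun θ =>
        (μ : ℂ) * (Complex.I * k * Real.cos θ * (Complex.I * k * Real.cos θ * c j θ) +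
          Complex.I * k * Real.sin θ * (Complex.I * k * Real.sin θ * c j θ)) +
        ((lam + μ : ℝ) : ℂ) * (Complex.I * k * dvecC θ j *
          (Complex.I * k * Real.cos θ * c 0 θ + Complex.I * k * Real.sin θ * c 1 θ)) +
        (ω : ℂ) ^ 2 * c j θ) z = 0 := by
    intro k c hc
    rw [planeWaveIntegral, intervalIntegral.integral_congr (g := fun _ => (0 : ℂ)),
      intervalIntegral.integral_zero]
    intro θ _
    refine mul_eq_zero_of_left ?_ _
    rw [hc θ]
    push_cast [-Complex.ofReal_cos, -Complex.ofReal_sin]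
    linear_combination
      (k : ℂ) ^ 2 * (μ * c j θ * ((Real.cos θ : ℂ) ^ 2 + (Real.sin θ : ℂ) ^ 2) +
        (lam + μ) * dvecC θ j * (Real.cos θ * c 0 θ + Real.sin θ * c 1 θ)) * Complex.I_sq -
      (k : ℂ) ^ 2 * μ * c j θ * hcs θ
  rw [twoWaveIntegral]
  rw [hzero kp a (hp j), hzero ks b (hs j), add_zero]

theorem herglotzU_eq_twoWaveIntegral (μ lam kp ks θ₁ θ₂ : ℝ) (q : Fin 2 → ℂ) :
    herglotzU μ lam kp ks θ₁ θ₂ q = fun x j => twoWaveIntegral θ₁ θ₂ kp ks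
      (fun θ => (1 / ((lam : ℂ) + 2 * μ)) * (dvecC θ 0 * q 0 + dvecC θ 1 * q 1) * dvecC θ j)
      (fun θ => (1 / (μ : ℂ)) * (q j - (dvecC θ 0 * q 0 + dvecC θ 1 * q 1) * dvecC θ j)) x := by
  funext x j
  have hd := continuous_dvecC
  exact intervalIntegral.integral_add
    ((continuous_planeWave_integrand kp (by fun_prop) x).intervalIntegrable _ _)
    ((continuous_planeWave_integrand ks (by fun_prop) x).intervalIntegrable _ _)

/-- the field `U` is smooth on `ℝ²` and satisfies the Navier equation
`μ ΔU + (λ+μ) ∇(div U) + ω² U = 0` on all of `ℝ²`. -/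
theorem statement7 (μ lam ω kp ks θ₁ θ₂ : ℝ)
    (hμ : 0 < μ) (hlam : 0 ≤ lam + μ) (hω : 0 < ω)
    (hkp : kp = ω / Real.sqrt (2 * μ + lam)) (hks : ks = ω / Real.sqrt μ)
    (hθ : θ₁ ≤ θ₂) (q : Fin 2 → ℂ) :
    ContDiff ℝ (⊤ : ℕ∞) (herglotzU μ lam kp ks θ₁ θ₂ q) ∧
      ∀ z : ℝ × ℝ, navierAt μ lam ω (herglotzU μ lam kp ks θ₁ θ₂ q) z := by
  have hd := continuous_dvecC
  rw [herglotzU_eq_twoWaveIntegral]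
  refine ⟨contDiff_pi.2 fun j => ?_, navierAt_twoWaveIntegral (by fun_prop) (by fun_prop) ?_ ?_⟩
  · exact (contDiff_planeWaveIntegral θ₁ θ₂ kp (by fun_prop)).add
      (contDiff_planeWaveIntegral θ₁ θ₂ ks (by fun_prop))
  · have hpos : 0 < 2 * μ + lam := by linarith
    have hk : (ω : ℂ) ^ 2 = (kp : ℂ) ^ 2 * (lam + 2 * μ) := by
      have : ω ^ 2 = kp ^ 2 * (lam + 2 * μ) := by
        rw [hkp, div_pow, Real.sq_sqrt hpos.le]
        field_simp
        ring
      exact_mod_cast this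
    intro j θ
    have hcs : (Real.cos θ : ℂ) ^ 2 + (Real.sin θ : ℂ) ^ 2 = 1 := by
      exact_mod_cast Real.cos_sq_add_sin_sq θ
    have h0 : dvecC θ 0 = Real.cos θ := rfl
    have h1 : dvecC θ 1 = Real.sin θ := rfl
    rw [hk, h0, h1]
    generalize (1 / ((lam : ℂ) + 2 * μ)) = c
    linear_combination -(kp : ℂ) ^ 2 * (lam + μ) * dvecC θ j * c *
      (Real.cos θ * q 0 + Real.sin θ * q 1) * hcs
  · have hk : (ω : ℂ) ^ 2 = (ks : ℂ) ^ 2 * μ := by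
      have : ω ^ 2 = ks ^ 2 * μ := by
        rw [hks, div_pow, Real.sq_sqrt hμ.le]
        field_simp
      exact_mod_cast this
    intro j θ
    have hcs : (Real.cos θ : ℂ) ^ 2 + (Real.sin θ : ℂ) ^ 2 = 1 := by
      exact_mod_cast Real.cos_sq_add_sin_sq θ
    have h0 : dvecC θ 0 = Real.cos θ := rfl
    have h1 : dvecC θ 1 = Real.sin θ := rfl
    rw [hk, h0, h1]
    generalize (1 / (μ : ℂ)) = c
    linear_combination (ks : ℂ) ^ 2 * (lam + μ) * dvecC θ j * c *
      (Real.cos θ * q 0 + Real.sin θ * q 1) * hcs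
end
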